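/- There is no weak solution on [0, 1/2] with initial condition X_0 = 0 to the SDE dX_t = b(X_t) dt + dB_t, where b(x) = −1/(2x) for 0 < |x| ≤ 1, b(0) = 0, and b(x) = f(x) for |x| > 1, for any measurable f : ℝ → ℝ. That is, there is no filtered probability space carrying a Brownian motion B and a continuous adapted process X with X_0 = 0 such that X_t = ∫_0^t b(X_s) ds + B_t almost surely for all t ∈ [0, 1/2]. -/

import Mathlib

open MeasureTheory ProbabilityTheory Set
open scoped Classical

noncomputable section

/-- `B` is a Brownian motion with respect to the filtration `F` under `P`
(properties required for times `t ≥ 0`). -/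
def IsBrownian {Ω : Type*} [MeasurableSpace Ω] (F : ℝ → MeasurableSpace Ω)
    (P : Measure Ω) (B : ℝ → Ω → ℝ) : Prop :=
  (∀ ω, Continuous fun t => B t ω) ∧
  (∀ᵐ ω ∂P, B 0 ω = 0) ∧
  (∀ t, 0 ≤ t → Measurable[F t] (B t)) ∧
  (∀ s t, 0 ≤ s → s ≤ t →
    Indep (MeasurableSpace.comap (fun ω => B t ω - B s ω)
      (inferInstance : MeasurableSpace ℝ)) (F s) P) ∧
  (∀ s t, 0 ≤ s → s ≤ t →
    Measure.map (fun ω => B t ω - B s ω) P = gaussianReal 0 (Real.toNNReal (t - s)))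

/-- `(X, B)` is a weak solution on `[0, T]` of `dX = b(t, X) dt + dB` with
initial condition `x₀`, on a filtered space `(Ω, F, P)`. -/
def IsWeakSolutionOn {Ω : Type*} [m : MeasurableSpace Ω] (F : ℝ → MeasurableSpace Ω)
    (P : Measure Ω) (b : ℝ → ℝ → ℝ) (X B : ℝ → Ω → ℝ) (x₀ : Ω → ℝ) (T : ℝ) : Prop :=
  (∀ t, 0 ≤ t → F t ≤ m) ∧
  (∀ s t, 0 ≤ s → s ≤ t → F s ≤ F t) ∧
  IsBrownian F P B ∧
  (∀ ω, Continuous fun t => X t ω) ∧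
  (∀ t, 0 ≤ t → Measurable[F t] (X t)) ∧
  (∀ᵐ ω ∂P, X 0 ω = x₀ ω) ∧
  (∀ᵐ ω ∂P, ∀ t ∈ Set.Icc (0 : ℝ) T,
    IntegrableOn (fun s => b s (X s ω)) (Set.Icc 0 t) ∧
    X t ω = x₀ ω + (∫ s in (0:ℝ)..t, b s (X s ω)) + B t ω)

/-- The drift `b(x) = -1/(2x)` for `0 < |x| ≤ 1`, `b(0) = 0`, and `b(x) = f(x)`
for `|x| > 1`. -/
def bSing (f : ℝ → ℝ) (x : ℝ) : ℝ :=
  if x ≠ 0 ∧ |x| ≤ 1 then -1 / (2 * x) else if 1 < |x| then f x else 0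

/-- `G` is a nonnegative bounded `C²` function vanishing at `0`, with first and second derivatives
`G₁`, `G₂` bounded and Lipschitz, on which the generator `b ∂ + ∂² / 2` is at most `1`. -/
structure IsTestFunction (b G G₁ G₂ : ℝ → ℝ) (L M : ℝ) : Prop where
  nonneg : ∀ x, 0 ≤ G x
  zero : G 0 = 0
  le : ∀ x, G x ≤ M
  hasDerivAt : ∀ x, HasDerivAt G (G₁ x) x
  hasDerivAt' : ∀ x, HasDerivAt G₁ (G₂ x) x
  abs_deriv_le : ∀ x, |G₁ x| ≤ L
  abs_deriv_deriv_le : ∀ x, |G₂ x| ≤ L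
  abs_sub_le : ∀ x y, |G₂ y - G₂ x| ≤ L * |y - x|
  generator_le : ∀ x, G₁ x * b x + G₂ x / 2 ≤ 1

lemma abs_sub_le_of_forall_hasDerivAt {φ φ' : ℝ → ℝ} {C x y : ℝ}
    (h : ∀ z, HasDerivAt φ (φ' z) z) (hC : ∀ z ∈ uIcc x y, |φ' z| ≤ C) :
    |φ y - φ x| ≤ C * |y - x| :=
  Convex.norm_image_sub_le_of_norm_hasDerivWithin_le (s := uIcc x y)
    (fun z _ => (h z).hasDerivWithinAt) hC (convex_uIcc x y) left_mem_uIcc right_mem_uIcc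

namespace IsTestFunction

variable {b G G₁ G₂ : ℝ → ℝ} {L M : ℝ}

lemma const_nonneg (h : IsTestFunction b G G₁ G₂ L M) : 0 ≤ L :=
  (abs_nonneg _).trans (h.abs_deriv_le 0)

lemma bound_nonneg (h : IsTestFunction b G G₁ G₂ L M) : 0 ≤ M :=
  (h.nonneg 0).trans (h.le 0)

lemma abs_sub_le_mul (h : IsTestFunction b G G₁ G₂ L M) (x y : ℝ) :
    |G y - G x| ≤ L * |y - x| :=
  abs_sub_le_of_forall_hasDerivAt h.hasDerivAt fun z _ => h.abs_deriv_le z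

lemma abs_deriv_sub_le_mul (h : IsTestFunction b G G₁ G₂ L M) (x y : ℝ) :
    |G₁ y - G₁ x| ≤ L * |y - x| :=
  abs_sub_le_of_forall_hasDerivAt h.hasDerivAt' fun z _ => h.abs_deriv_deriv_le z

lemma continuous (h : IsTestFunction b G G₁ G₂ L M) : Continuous G :=
  continuous_iff_continuousAt.2 fun x => (h.hasDerivAt x).continuousAt

lemma continuous_deriv (h : IsTestFunction b G G₁ G₂ L M) : Continuous G₁ :=
  continuous_iff_continuousAt.2 fun x => (h.hasDerivAt' x).continuousAt

lemma continuous_deriv_deriv (h : IsTestFunction b G G₁ G₂ L M) : Continuous G₂ :=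
  (LipschitzWith.of_dist_le_mul (K := ⟨L, h.const_nonneg⟩) fun x y =>
    h.abs_sub_le y x).continuous

lemma taylor_one (h : IsTestFunction b G G₁ G₂ L M) (x y : ℝ) :
    |G y - G x - G₁ x * (y - x)| ≤ L * |y - x| * |y - x| := by
  have hd : ∀ z, HasDerivAt (fun z => G z - G₁ x * z) (G₁ z - G₁ x) z := fun z => by
    simpa using (h.hasDerivAt z).fun_sub ((hasDerivAt_id' z).const_mul (G₁ x))
  have := abs_sub_le_of_forall_hasDerivAt (x := x) (y := y) (C := L * |y - x|) hd fun z hz =>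
    (h.abs_deriv_sub_le_mul x z).trans
      (mul_le_mul_of_nonneg_left (abs_sub_left_of_mem_uIcc hz) h.const_nonneg)
  convert this using 2
  ring

lemma taylor_two (h : IsTestFunction b G G₁ G₂ L M) (x y : ℝ) :
    |G y - G x - G₁ x * (y - x) - G₂ x / 2 * (y - x) ^ 2| ≤ L * |y - x| ^ 3 := by
  have hd : ∀ z, HasDerivAt (fun z => G₁ z - G₂ x * z) (G₂ z - G₂ x) z := fun z => by
    simpa using (h.hasDerivAt' z).fun_sub ((hasDerivAt_id' z).const_mul (G₂ x))
  have hd' : ∀ z, HasDerivAt (fun z => G z - G₁ x * (z - x) - G₂ x / 2 * (z - x) ^ 2)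
      (G₁ z - G₁ x - G₂ x * (z - x)) z := fun z => by
    have h₁ := (hasDerivAt_id' z).sub_const x
    refine (((h.hasDerivAt z).fun_sub (h₁.const_mul (G₁ x))).fun_sub
      ((h₁.fun_pow 2).const_mul (G₂ x / 2))).congr_deriv ?_
    norm_num
    ring
  have hb : ∀ z ∈ uIcc x y, |G₁ z - G₁ x - G₂ x * (z - x)| ≤ L * |y - x| * |y - x| := by
    intro z hz
    have hzy := abs_sub_left_of_mem_uIcc hz
    have := abs_sub_le_of_forall_hasDerivAt (x := x) (y := z) (C := L * |z - x|) hd fun w hw =>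
      (h.abs_sub_le x w).trans
        (mul_le_mul_of_nonneg_left (abs_sub_left_of_mem_uIcc hw) h.const_nonneg)
    have e : G₁ z - G₁ x - G₂ x * (z - x) = G₁ z - G₂ x * z - (G₁ x - G₂ x * x) := by ring
    rw [e]
    refine this.trans ?_
    have := h.const_nonneg
    gcongr
  have := abs_sub_le_of_forall_hasDerivAt hd' hb
  calc _ = _ := by congr 1; ring
    _ ≤ _ := this
    _ = _ := by ring

end IsTestFunction

/-- A radial profile `k` yields the test function `x ↦ (∫₀^{x²} k) / 2`. -/
lemma exists_isTestFunction_of_profile (f : ℝ → ℝ) {k : ℝ → ℝ} (hk : ContDiff ℝ 3 k)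
    (h0 : k 0 = 0) (hnonneg : ∀ u, 0 ≤ k u) (hk1 : ∀ u, 1 ≤ u → k u = 0)
    (hderiv : ∀ u, 0 ≤ u → u * deriv k u ≤ 1) :
    ∃ G₁ G₂ L M, IsTestFunction (bSing f) (fun x => (∫ u in (0:ℝ)..x ^ 2, k u) / 2)
      G₁ G₂ L M := by
  have hkc := hk.continuous
  have hi : ∀ a c, IntervalIntegrable k volume a c := fun a c => hkc.intervalIntegrable a c
  have hG₁ : ContDiff ℝ 3 fun x => x * k (x ^ 2) := by fun_prop
  have hd2 : ∀ x, HasDerivAt (fun x => x * k (x ^ 2))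
      (k (x ^ 2) + 2 * x ^ 2 * deriv k (x ^ 2)) x := fun x => by
    have h1 : HasDerivAt k (deriv k (x ^ 2)) (x ^ 2) :=
      (hk.differentiable (by norm_num) _).hasDerivAt
    have h2 : HasDerivAt (fun x : ℝ => x ^ 2) (2 * x) x := by simpa using hasDerivAt_pow 2 x
    have h3 : HasDerivAt (fun x => k (x ^ 2)) (deriv k (x ^ 2) * (2 * x)) x :=
      HasDerivAt.comp (h := fun x : ℝ => x ^ 2) x h1 h2
    exact ((hasDerivAt_id' x).fun_mul h3).congr_deriv (by ring)
  have hsupp : HasCompactSupport fun x => x * k (x ^ 2) := by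
    refine HasCompactSupport.intro (isCompact_Icc (a := (-1 : ℝ)) (b := 1)) fun x hx => ?_
    have : 1 ≤ x ^ 2 := by
      by_contra! hlt
      exact hx (abs_le.1 ((sq_lt_one_iff_abs_lt_one x).1 hlt).le)
    simp [hk1 _ this]
  have hG₂ : ContDiff ℝ 2 (deriv fun x => x * k (x ^ 2)) := hG₁.deriv'
  have hG₃ : ContDiff ℝ 1 (deriv (deriv fun x => x * k (x ^ 2))) := hG₂.deriv'
  obtain ⟨C₁, hC₁⟩ := hG₁.continuous.bounded_above_of_compact_support hsupp
  obtain ⟨C₂, hC₂⟩ := hG₂.continuous.bounded_above_of_compact_support hsupp.deriv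
  obtain ⟨C₃, hC₃⟩ := hG₃.continuous.bounded_above_of_compact_support hsupp.deriv.deriv
  set L := max C₁ (max C₂ C₃)
  have hmono : ∀ a c, a ≤ c → ∫ u in (0:ℝ)..a, k u ≤ ∫ u in (0:ℝ)..c, k u := fun a c hac => by
    have := intervalIntegral.integral_nonneg (μ := volume) hac (fun u _ => hnonneg u)
    linarith [intervalIntegral.integral_add_adjacent_intervals (hi 0 a) (hi a c)]
  refine ⟨fun x => x * k (x ^ 2), deriv fun x => x * k (x ^ 2), L,
    (∫ u in (0:ℝ)..1, k u) / 2, ?_, ?_, ?_, ?_, ?_, ?_, ?_, ?_, ?_⟩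
  · intro x
    have := intervalIntegral.integral_nonneg (μ := volume) (sq_nonneg x) (fun u _ => hnonneg u)
    positivity
  · simp
  · intro x
    gcongr ?_ / 2
    rcases le_total (x ^ 2) 1 with hx | hx
    · exact hmono _ _ hx
    · rw [← intervalIntegral.integral_add_adjacent_intervals (hi 0 1) (hi 1 (x ^ 2))]
      have : ∫ u in (1:ℝ)..x ^ 2, k u = ∫ u in (1:ℝ)..x ^ 2, (0 : ℝ) := by
        refine intervalIntegral.integral_congr fun u hu => hk1 u ?_
        rw [uIcc_of_le hx] at hu
        exact hu.1
      simp [this]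
  · intro x
    have h1 : HasDerivAt (fun y => ∫ u in (0:ℝ)..y, k u) (k (x ^ 2)) (x ^ 2) :=
      intervalIntegral.integral_hasDerivAt_right (hi _ _)
        (hkc.stronglyMeasurableAtFilter _ _) hkc.continuousAt
    have h2 : HasDerivAt (fun x : ℝ => x ^ 2) (2 * x) x := by simpa using hasDerivAt_pow 2 x
    exact ((HasDerivAt.comp (h := fun x : ℝ => x ^ 2) x h1 h2).div_const 2).congr_deriv (by ring)
  · exact fun x => (hG₁.differentiable (by norm_num) x).hasDerivAt
  · exact fun x => (hC₁ x).trans (le_max_left _ _)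
  · exact fun x => (hC₂ x).trans ((le_max_left _ _).trans (le_max_right _ _))
  · exact fun x y => abs_sub_le_of_forall_hasDerivAt
      (fun z => (hG₂.differentiable (by norm_num) z).hasDerivAt)
      fun z _ => (hC₃ z).trans ((le_max_right _ _).trans (le_max_right _ _))
  · intro x
    rw [(hd2 x).deriv]
    have h1 := hderiv (x ^ 2) (sq_nonneg x)
    rcases eq_or_ne x 0 with rfl | hx
    · simp [h0]
    by_cases hx1 : |x| ≤ 1
    · have : x * k (x ^ 2) * bSing f x = - k (x ^ 2) / 2 := by
        rw [bSing, if_pos ⟨hx, hx1⟩]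
        field_simp
      rw [this]
      linarith
    · have : k (x ^ 2) = 0 := hk1 _ ((one_le_sq_iff_one_le_abs x).2 (not_le.1 hx1).le)
      rw [this]
      linarith

/-- The radial profile `log (1 + N u²) / 2`, cut off smoothly at `u = 1`. -/
def logProfile (N u : ℝ) : ℝ :=
  Real.log (1 + N * u ^ 2) / 2 * Real.smoothTransition (1 - u)

lemma contDiff_logProfile {N : ℝ} (hN : 0 ≤ N) : ContDiff ℝ 3 (logProfile N) := by
  have h1 : ContDiff ℝ 3 fun u : ℝ => Real.log (1 + N * u ^ 2) :=
    ContDiff.log (by fun_prop) fun u => by positivity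
  have h2 : ContDiff ℝ 3 fun u : ℝ => Real.smoothTransition (1 - u) :=
    (Real.smoothTransition.contDiff (n := 3)).comp (by fun_prop)
  exact (h1.div_const 2).mul h2

lemma logProfile_nonneg {N : ℝ} (hN : 0 ≤ N) (u : ℝ) : 0 ≤ logProfile N u := by
  have : 0 ≤ Real.log (1 + N * u ^ 2) := Real.log_nonneg (by nlinarith [sq_nonneg u])
  have := Real.smoothTransition.nonneg (1 - u)
  unfold logProfile
  positivity

lemma mul_deriv_logProfile_le {N : ℝ} (hN : 0 ≤ N) {u : ℝ} (hu : 0 ≤ u) :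
    u * deriv (logProfile N) u ≤ 1 := by
  have hpos : 0 < 1 + N * u ^ 2 := by positivity
  have hs : HasDerivAt Real.smoothTransition (deriv Real.smoothTransition (1 - u)) (1 - u) :=
    ((Real.smoothTransition.contDiff (n := 1)).differentiable (by norm_num) _).hasDerivAt
  have hs' : 0 ≤ deriv Real.smoothTransition (1 - u) := Real.smoothTransition.monotone.deriv_nonneg
  have h1 : HasDerivAt (fun u : ℝ => 1 + N * u ^ 2) (N * (2 * u)) u := by
    simpa using ((hasDerivAt_pow 2 u).const_mul N).const_add 1
  have h2 : HasDerivAt (fun u => Real.smoothTransition (1 - u))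
      (-deriv Real.smoothTransition (1 - u)) u := by
    exact (HasDerivAt.comp (h := fun u : ℝ => 1 - u) u hs
      ((hasDerivAt_id' u).const_sub 1)).congr_deriv (by ring)
  have h3 : HasDerivAt (logProfile N) _ u := ((h1.log hpos.ne').div_const 2).mul h2
  rw [h3.deriv]
  have hlog : 0 ≤ Real.log (1 + N * u ^ 2) := Real.log_nonneg (by nlinarith [sq_nonneg u])
  have h4 : 0 ≤ u * (Real.log (1 + N * u ^ 2) / 2 * deriv Real.smoothTransition (1 - u)) := by
    positivity
  have h5 : u * (N * (2 * u) / (1 + N * u ^ 2) / 2) ≤ 1 := by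
    have : u * (N * (2 * u) / (1 + N * u ^ 2) / 2) = N * u ^ 2 / (1 + N * u ^ 2) := by
      field_simp
    rw [this, div_le_one hpos]
    linarith
  have h6 : 0 ≤ u * (N * (2 * u) / (1 + N * u ^ 2) / 2) := by positivity
  nlinarith [Real.smoothTransition.nonneg (1 - u), Real.smoothTransition.le_one (1 - u)]

lemma exists_isTestFunction_ge (f : ℝ → ℝ) {r : ℝ} (hr : 0 < r) (hr1 : r < 1) (C : ℝ) :
    ∃ G G₁ G₂ L M, IsTestFunction (bSing f) G G₁ G₂ L M ∧ ∀ x, r ≤ |x| → C ≤ G x := by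
  set q : ℝ := r ^ 2 with hq
  have hq0 : 0 < q := by positivity
  have hq1 : q < 1 := by nlinarith
  have hs : 0 < Real.smoothTransition (1 - q) := Real.smoothTransition.pos_of_pos (by linarith)
  have hlim : Filter.Tendsto (fun N : ℝ => Real.log (1 + N * (q / 2) ^ 2)) Filter.atTop
      Filter.atTop :=
    Real.tendsto_log_atTop.comp (Filter.tendsto_atTop_add_const_left _ _
      (Filter.tendsto_id.atTop_mul_const (by positivity)))
  obtain ⟨N, hNC, hN⟩ := ((hlim.eventually_ge_atTop
    (8 * C / (q * Real.smoothTransition (1 - q)))).and (Filter.eventually_ge_atTop 0)).exists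
  have hnn := logProfile_nonneg hN
  obtain ⟨G₁, G₂, L, M, hG⟩ := exists_isTestFunction_of_profile f (contDiff_logProfile hN)
    (by simp [logProfile]) hnn
    (fun u hu => by simp [logProfile, Real.smoothTransition.zero_of_nonpos (sub_nonpos.2 hu)])
    (fun u hu => mul_deriv_logProfile_le hN hu)
  refine ⟨_, G₁, G₂, L, M, hG, fun x hx => ?_⟩
  have hi : ∀ a c, IntervalIntegrable (logProfile N) volume a c := fun a c =>
    (contDiff_logProfile hN).continuous.intervalIntegrable a c
  have hqx : q ≤ x ^ 2 := by
    rw [hq, ← sq_abs x]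
    gcongr
  have e1 := intervalIntegral.integral_add_adjacent_intervals (hi 0 (q / 2)) (hi (q / 2) q)
  have e2 := intervalIntegral.integral_add_adjacent_intervals (hi 0 q) (hi q (x ^ 2))
  have p1 := intervalIntegral.integral_nonneg (μ := volume) (a := 0) (b := q / 2) (by positivity)
    (fun u _ => hnn u)
  have p2 := intervalIntegral.integral_nonneg (μ := volume) hqx (fun u _ => hnn u)
  rw [div_le_iff₀ (by positivity)] at hNC
  have hlow : ∀ u ∈ Icc (q / 2) q, 4 * C / q ≤ logProfile N u := by
    intro u hu
    have h0 : 0 ≤ Real.log (1 + N * (q / 2) ^ 2) :=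
      Real.log_nonneg (by nlinarith [sq_nonneg (q / 2)])
    have h1 : Real.log (1 + N * (q / 2) ^ 2) ≤ Real.log (1 + N * u ^ 2) := by
      have := hu.1
      apply Real.log_le_log (by positivity)
      gcongr
    have h2 : Real.smoothTransition (1 - q) ≤ Real.smoothTransition (1 - u) :=
      Real.smoothTransition.monotone (by linarith [hu.2])
    have h3 := mul_le_mul h1 h2 hs.le (h0.trans h1)
    have h4 : 4 * C / q ≤ Real.log (1 + N * (q / 2) ^ 2) * Real.smoothTransition (1 - q) / 2 := by
      rw [div_le_iff₀ hq0]
      linarith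
    unfold logProfile
    linarith
  have hint := intervalIntegral.integral_mono_on (μ := volume) (a := q / 2) (b := q)
    (by linarith) (by simp) (hi _ _) (f := fun _ => 4 * C / q) (g := logProfile N) hlow
  rw [intervalIntegral.integral_const, smul_eq_mul] at hint
  have e3 : (q - q / 2) * (4 * C / q) = 2 * C := by
    field_simp
    ring
  linarith

/-- The defect of the second-order expansion of `G` over a time step of length `h`, where the state
moves from `x` to `y` and the noise increment is `β`. -/
def stepDefect (G G₁ G₂ : ℝ → ℝ) (L h x y β : ℝ) : ℝ :=
  G y - G x - G₁ x * β - G₂ x / 2 * (β ^ 2 - h) - L * |β| ^ 3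

/-- The `i`-th point of the uniform subdivision of `[0, T]` into `n` intervals. -/
def gridPoint (T : ℝ) (n i : ℕ) : ℝ := i * (T / n)

lemma gridPoint_succ_sub (T : ℝ) (n i : ℕ) :
    gridPoint T n (i + 1) - gridPoint T n i = T / n := by
  simp [gridPoint]
  ring

lemma gridPoint_zero (T : ℝ) (n : ℕ) : gridPoint T n 0 = 0 := by simp [gridPoint]

lemma gridPoint_self (T : ℝ) {n : ℕ} (hn : n ≠ 0) : gridPoint T n n = T := by
  simp [gridPoint]
  field_simp

lemma monotone_gridPoint {T : ℝ} (hT : 0 ≤ T) (n : ℕ) : Monotone (gridPoint T n) := by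
  intro i j hij
  unfold gridPoint
  gcongr

lemma gridPoint_nonneg {T : ℝ} (hT : 0 ≤ T) (n i : ℕ) : 0 ≤ gridPoint T n i := by
  unfold gridPoint
  positivity

lemma gridPoint_mem_Icc {T : ℝ} (hT : 0 ≤ T) {n i : ℕ} (hi : i ≤ n) :
    gridPoint T n i ∈ Icc 0 T := by
  refine ⟨gridPoint_nonneg hT n i, ?_⟩
  rcases eq_or_ne n 0 with rfl | hn
  · simpa [gridPoint] using hT
  · exact (monotone_gridPoint hT n hi).trans_eq (gridPoint_self T hn)

/-- A continuous path `x` driven by the continuous path `B` with drift `b` on `[0, T]`. -/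
structure IsDrivenPath (b x B : ℝ → ℝ) (T : ℝ) : Prop where
  continuous : Continuous x
  continuous_noise : Continuous B
  integrableOn : IntegrableOn (fun s => b (x s)) (Icc 0 T)
  eq : ∀ t ∈ Icc 0 T, x t = (∫ s in (0:ℝ)..t, b (x s)) + B t

/-- The total variation of the drift part of a driven path. -/
def driftVariation (b x : ℝ → ℝ) (t : ℝ) : ℝ := ∫ s in (0:ℝ)..t, |b (x s)|

namespace IsDrivenPath

variable {b x B : ℝ → ℝ} {T : ℝ}

lemma intervalIntegrable (h : IsDrivenPath b x B T) {s t : ℝ} (hs : 0 ≤ s) (hst : s ≤ t)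
    (ht : t ≤ T) : IntervalIntegrable (fun s => b (x s)) volume s t :=
  (h.integrableOn.mono_set (by rw [uIcc_of_le hst]; exact Icc_subset_Icc hs ht)).intervalIntegrable

lemma driftVariation_sub (h : IsDrivenPath b x B T) {s t : ℝ} (hs : 0 ≤ s) (hst : s ≤ t)
    (ht : t ≤ T) :
    driftVariation b x t - driftVariation b x s = ∫ u in s..t, |b (x u)| := by
  have h1 := (h.intervalIntegrable le_rfl hs (hst.trans ht)).abs
  have h2 := (h.intervalIntegrable hs hst ht).abs
  have := intervalIntegral.integral_add_adjacent_intervals h1 h2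
  unfold driftVariation
  linarith

lemma driftVariation_mono (h : IsDrivenPath b x B T) {s t : ℝ} (hs : 0 ≤ s) (hst : s ≤ t)
    (ht : t ≤ T) : driftVariation b x s ≤ driftVariation b x t := by
  have := intervalIntegral.integral_nonneg (μ := volume) hst (fun u _ => abs_nonneg (b (x u)))
  linarith [h.driftVariation_sub hs hst ht]

lemma increment (h : IsDrivenPath b x B T) {s t : ℝ} (hs : 0 ≤ s) (hst : s ≤ t) (ht : t ≤ T) :
    x t - x s - (B t - B s) = ∫ u in s..t, b (x u) := by
  have h1 := h.intervalIntegrable le_rfl hs (hst.trans ht)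
  have h2 := h.intervalIntegrable hs hst ht
  have := intervalIntegral.integral_add_adjacent_intervals h1 h2
  rw [h.eq t ⟨hs.trans hst, ht⟩, h.eq s ⟨hs, hst.trans ht⟩]
  linarith

lemma abs_increment_le (h : IsDrivenPath b x B T) {s t : ℝ} (hs : 0 ≤ s) (hst : s ≤ t)
    (ht : t ≤ T) :
    |x t - x s - (B t - B s)| ≤ driftVariation b x t - driftVariation b x s := by
  rw [h.increment hs hst ht, h.driftVariation_sub hs hst ht]
  exact intervalIntegral.abs_integral_le_integral_abs hst

variable {G G₁ G₂ : ℝ → ℝ} {L M : ℝ}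

lemma stepDefect_le_min (h : IsDrivenPath b x B T) (hG : IsTestFunction b G G₁ G₂ L M)
    {s t : ℝ} (hs : 0 ≤ s) (hst : s ≤ t) (ht : t ≤ T) :
    stepDefect G G₁ G₂ L (t - s) (x s) (x t) (B t - B s) ≤
      min (L * (driftVariation b x t - driftVariation b x s)) M + L * (t - s) := by
  set β := B t - B s
  have h1 := (abs_le.1 (hG.taylor_two (x s) (x s + β))).2
  rw [add_sub_cancel_left] at h1
  have h2 : G (x t) - G (x s + β) ≤ L * (driftVariation b x t - driftVariation b x s) := by
    refine (le_abs_self _).trans ((hG.abs_sub_le_mul _ _).trans ?_)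
    gcongr
    · exact hG.const_nonneg
    · rw [← sub_sub]
      exact h.abs_increment_le hs hst ht
  have h3 : G (x t) - G (x s + β) ≤ M := by linarith [hG.le (x t), hG.nonneg (x s + β)]
  have h4 : G₂ (x s) / 2 * (t - s) ≤ L * (t - s) := by
    have := (abs_le.1 (hG.abs_deriv_deriv_le (x s))).2
    have := hG.const_nonneg
    exact mul_le_mul_of_nonneg_right (by linarith) (by linarith)
  unfold stepDefect
  linarith [le_min h2 h3]

lemma stepDefect_le (h : IsDrivenPath b x B T) (hG : IsTestFunction b G G₁ G₂ L M)
    {s t ε : ℝ} (hs : 0 ≤ s) (hst : s ≤ t) (ht : t ≤ T)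
    (hx : ∀ u ∈ Icc s t, |x u - x s| ≤ ε) (hB : |B t - B s| ≤ ε) :
    stepDefect G G₁ G₂ L (t - s) (x s) (x t) (B t - B s) ≤
      (t - s) + L * ε * (4 * (driftVariation b x t - driftVariation b x s) + (t - s)) := by
  set β := B t - B s with hβ
  set a := x t - x s - β with ha
  have hL := hG.const_nonneg
  have h1 := (abs_le.1 (hG.taylor_two (x s) (x s + β))).2
  rw [add_sub_cancel_left] at h1
  have h2 := (abs_le.1 (hG.taylor_one (x s + β) (x t))).2
  have ea : x t - (x s + β) = a := by rw [ha]; ring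
  rw [ea] at h2
  have hav : |a| ≤ driftVariation b x t - driftVariation b x s := h.abs_increment_le hs hst ht
  have ha2 : |a| ≤ 2 * ε := by
    have := hx t ⟨hst, le_rfl⟩
    linarith [abs_sub (x t - x s) β]
  have h3 : (G₁ (x s + β) - G₁ (x s)) * a ≤ L * ε * |a| := by
    refine (le_abs_self _).trans ?_
    rw [abs_mul]
    gcongr
    refine (hG.abs_deriv_sub_le_mul _ _).trans ?_
    rw [add_sub_cancel_left]
    gcongr
  have h4 : L * |a| * |a| ≤ L * ε * (2 * |a|) := by
    have := mul_le_mul_of_nonneg_left ha2 (mul_nonneg hL (abs_nonneg a))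
    linarith
  have hb := h.intervalIntegrable hs hst ht
  have h5 : G₁ (x s) * a + G₂ (x s) / 2 * (t - s) ≤
      (t - s) + L * ε * ((driftVariation b x t - driftVariation b x s) + (t - s)) := by
    have e1 : G₁ (x s) * a + G₂ (x s) / 2 * (t - s) =
        ∫ u in s..t, (G₁ (x s) * b (x u) + G₂ (x s) / 2) := by
      rw [intervalIntegral.integral_add (hb.const_mul _) (by simp),
        intervalIntegral.integral_const_mul, ← h.increment hs hst ht]
      simp [ha, hβ]
      ring
    have e2 : (t - s) + L * ε * ((driftVariation b x t - driftVariation b x s) + (t - s)) =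
        ∫ u in s..t, (1 + L * ε * (|b (x u)| + 1)) := by
      rw [intervalIntegral.integral_add (by simp)
        ((hb.abs.add (by simp)).const_mul _), intervalIntegral.integral_const_mul,
        intervalIntegral.integral_add hb.abs (by simp), ← h.driftVariation_sub hs hst ht]
      simp
    rw [e1, e2]
    refine intervalIntegral.integral_mono_on hst ((hb.const_mul _).add (by simp))
      (IntervalIntegrable.add (by simp) ((hb.abs.add (by simp)).const_mul _)) fun u hu => ?_
    have g1 := hG.generator_le (x u)
    have g2 : (G₁ (x s) - G₁ (x u)) * b (x u) ≤ L * ε * |b (x u)| := by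
      refine (le_abs_self _).trans ?_
      rw [abs_mul]
      gcongr
      refine (hG.abs_deriv_sub_le_mul _ _).trans ?_
      rw [abs_sub_comm]
      exact mul_le_mul_of_nonneg_left (hx u hu) hL
    have g3 : G₂ (x s) - G₂ (x u) ≤ L * ε := by
      refine (le_abs_self _).trans ((hG.abs_sub_le _ _).trans ?_)
      rw [abs_sub_comm]
      exact mul_le_mul_of_nonneg_left (hx u hu) hL
    have g4 : 0 ≤ L * ε := mul_nonneg hL ((abs_nonneg _).trans hB)
    linarith
  have h6 : L * ε * |a| ≤ L * ε * (driftVariation b x t - driftVariation b x s) :=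
    mul_le_mul_of_nonneg_left hav (mul_nonneg hL ((abs_nonneg _).trans hB))
  unfold stepDefect
  linarith

lemma eventually_sum_stepDefect_le (h : IsDrivenPath b x B T) (hG : IsTestFunction b G G₁ G₂ L M)
    (hT : 0 ≤ T) {w : ℝ → ℝ} (hw0 : ∀ t, 0 ≤ w t) (hw1 : ∀ t, w t ≤ 1) {η : ℝ} (hη : 0 < η) :
    ∀ᶠ n : ℕ in Filter.atTop, ∑ i ∈ Finset.range n, w (gridPoint T n i) *
      stepDefect G G₁ G₂ L (T / n) (x (gridPoint T n i)) (x (gridPoint T n (i + 1)))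
        (B (gridPoint T n (i + 1)) - B (gridPoint T n i)) ≤ T + η := by
  have hL := hG.const_nonneg
  have hv0 : driftVariation b x 0 = 0 := by simp [driftVariation]
  set V := driftVariation b x T with hV
  have hVnn : 0 ≤ V := hv0 ▸ h.driftVariation_mono le_rfl hT le_rfl
  set c : ℝ := L * (4 * V + T) with hc
  have hc0 : 0 ≤ c := by positivity
  set ε : ℝ := η / (c + 1) with hε
  have hε0 : 0 < ε := by positivity
  have hcε : ε * c ≤ η := by
    rw [hε, div_mul_eq_mul_div, div_le_iff₀ (by positivity)]
    nlinarith
  obtain ⟨δ₁, hδ₁, H₁⟩ := Metric.uniformContinuousOn_iff_le.1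
    (isCompact_Icc.uniformContinuousOn_of_continuous (s := Icc 0 T) h.continuous.continuousOn) ε hε0
  obtain ⟨δ₂, hδ₂, H₂⟩ := Metric.uniformContinuousOn_iff_le.1
    (isCompact_Icc.uniformContinuousOn_of_continuous (s := Icc 0 T)
      h.continuous_noise.continuousOn) ε hε0
  have hlim : Filter.Tendsto (fun n : ℕ => T / n) Filter.atTop (nhds 0) :=
    tendsto_const_div_atTop_nhds_zero_nat T
  filter_upwards [hlim.eventually_le_const (lt_min hδ₁ hδ₂), Filter.eventually_ne_atTop 0]
    with n hn hn0
  have hTn : 0 ≤ T / n := by positivity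
  calc _ ≤ ∑ i ∈ Finset.range n, (T / n + L * ε * (4 * (driftVariation b x (gridPoint T n (i + 1)) -
        driftVariation b x (gridPoint T n i)) + T / n)) := by
        refine Finset.sum_le_sum fun i hi => ?_
        have hi1 : i + 1 ≤ n := Finset.mem_range.1 hi
        have m0 := gridPoint_mem_Icc hT ((Nat.le_succ i).trans hi1)
        have m1 := gridPoint_mem_Icc hT hi1
        have hst := monotone_gridPoint hT n (Nat.le_succ i)
        have hd := gridPoint_succ_sub T n i
        have key := h.stepDefect_le hG (ε := ε) m0.1 hst m1.2 (fun u hu => by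
            refine H₁ u ⟨m0.1.trans hu.1, hu.2.trans m1.2⟩ _ m0 ?_
            rw [Real.dist_eq, abs_of_nonneg (by linarith [hu.1])]
            have := hn.trans (min_le_left _ _)
            linarith [hu.2])
          (by
            refine H₂ _ m1 _ m0 ?_
            rw [Real.dist_eq, hd, abs_of_nonneg hTn]
            exact hn.trans (min_le_right _ _))
        rw [hd] at key
        have hmono := h.driftVariation_mono m0.1 hst m1.2
        refine (mul_le_mul_of_nonneg_left key (hw0 _)).trans (mul_le_of_le_one_left ?_ (hw1 _))
        have : 0 ≤ driftVariation b x (gridPoint T n (i + 1)) -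
          driftVariation b x (gridPoint T n i) := by linarith
        positivity
    _ = T + ε * c := by
        have e : ∑ i ∈ Finset.range n, (driftVariation b x (gridPoint T n (i + 1)) -
            driftVariation b x (gridPoint T n i)) = V := by
          rw [Finset.sum_range_sub (fun i => driftVariation b x (gridPoint T n i)),
            gridPoint_self T hn0, gridPoint_zero, hv0, sub_zero]
        have e' : (n : ℝ) * (T / n) = T := by field_simp
        rw [Finset.sum_add_distrib, ← Finset.mul_sum, Finset.sum_add_distrib, ← Finset.mul_sum, e]
        simp only [Finset.sum_const, Finset.card_range, nsmul_eq_mul, e', hc]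
        ring
    _ ≤ T + η := by linarith

end IsDrivenPath

lemma sum_min_increment_le {v : ℕ → ℝ} {K L M : ℝ} {n : ℕ} (hL : 0 ≤ L) (hM : 0 ≤ M)
    (hv0 : v 0 = 0) (hv : ∀ i < n, v i ≤ v (i + 1)) (hK : 0 ≤ K) :
    ∑ i ∈ Finset.range n, (if v i ≤ K then (1 : ℝ) else 0) * min (L * (v (i + 1) - v i)) M ≤
      min (L * v n) (L * K + M) := by
  induction n with
  | zero => simp [hv0]; positivity
  | succ n ih =>
    have ih := ih fun i hi => hv i (by omega)
    have hvn := mul_le_mul_of_nonneg_left (hv n (by omega)) hL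
    rw [Finset.sum_range_succ]
    have h1 := ih.trans (min_le_left _ _)
    have h2 := ih.trans (min_le_right _ _)
    split_ifs with h
    · have h3 := min_le_left (L * (v (n + 1) - v n)) M
      have h4 := min_le_right (L * (v (n + 1) - v n)) M
      have h5 := mul_le_mul_of_nonneg_left h hL
      apply le_min <;> linarith
    · apply le_min <;> linarith

lemma IsDrivenPath.sum_stepDefect_le {b x B G G₁ G₂ : ℝ → ℝ} {L M T K : ℝ}
    (h : IsDrivenPath b x B T) (hG : IsTestFunction b G G₁ G₂ L M) (hT : 0 ≤ T) (hK : 0 ≤ K)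
    (n : ℕ) :
    ∑ i ∈ Finset.range n, (if driftVariation b x (gridPoint T n i) ≤ K then (1 : ℝ) else 0) *
      stepDefect G G₁ G₂ L (T / n) (x (gridPoint T n i)) (x (gridPoint T n (i + 1)))
        (B (gridPoint T n (i + 1)) - B (gridPoint T n i)) ≤ L * K + M + L * T := by
  have hL := hG.const_nonneg
  have hTn : 0 ≤ T / n := by positivity
  have hsum := sum_min_increment_le (v := fun i => driftVariation b x (gridPoint T n i)) (K := K)
    (n := n) hL hG.bound_nonneg (by simp [driftVariation, gridPoint_zero]) (fun i hi =>
      h.driftVariation_mono (gridPoint_nonneg hT n i) (monotone_gridPoint hT n (Nat.le_succ i))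
        (gridPoint_mem_Icc hT hi).2) hK
  have hLT : ∑ i ∈ Finset.range n, L * (T / n) ≤ L * T := by
    rcases eq_or_ne n 0 with rfl | hn
    · simp; positivity
    · rw [Finset.sum_const, Finset.card_range, nsmul_eq_mul]
      apply le_of_eq
      field_simp
  calc _ ≤ ∑ i ∈ Finset.range n, ((if driftVariation b x (gridPoint T n i) ≤ K then (1 : ℝ) else 0)
        * min (L * (driftVariation b x (gridPoint T n (i + 1)) -
          driftVariation b x (gridPoint T n i))) M + L * (T / n)) := by
        refine Finset.sum_le_sum fun i hi => ?_
        have key := h.stepDefect_le_min hG (gridPoint_nonneg hT n i)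
          (monotone_gridPoint hT n (Nat.le_succ i))
          (gridPoint_mem_Icc hT (Finset.mem_range.1 hi)).2
        rw [gridPoint_succ_sub] at key
        split_ifs
        · linarith
        · simp only [zero_mul, zero_add]
          positivity
    _ ≤ _ := by
        rw [Finset.sum_add_distrib]
        linarith [hsum.trans (min_le_right _ _)]

section Moments

variable {Ω : Type*} {m : MeasurableSpace Ω} {P : Measure Ω} {β : Ω → ℝ} {h : ℝ}

lemma memLp_of_map_eq_gaussianReal {v : NNReal} (hβ : Measurable β)
    (hlaw : P.map β = gaussianReal 0 v) (p : NNReal) : MemLp β p P := by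
  have := memLp_id_gaussianReal (μ := 0) (v := v) p
  rw [← hlaw] at this
  exact (memLp_map_measure_iff aestronglyMeasurable_id hβ.aemeasurable).1 this

lemma integrable_abs_pow_of_map_eq_gaussianReal {v : NNReal} (hβ : Measurable β)
    (hlaw : P.map β = gaussianReal 0 v) {k : ℕ} (hk : k ≠ 0) :
    Integrable (fun ω => |β ω| ^ k) P := by
  have := memLp_of_map_eq_gaussianReal hβ hlaw k
  exact MemLp.integrable_norm_pow (p := k) (by simpa using this) hk

lemma integral_eq_zero_of_map_eq_gaussianReal {v : NNReal} (hβ : Measurable β)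
    (hlaw : P.map β = gaussianReal 0 v) : ∫ ω, β ω ∂P = 0 := by
  have := integral_id_gaussianReal (μ := 0) (v := v)
  rwa [← hlaw, integral_map hβ.aemeasurable (by fun_prop)] at this

lemma integral_sq_of_map_eq_gaussianReal (hh : 0 ≤ h) (hβ : Measurable β)
    (hlaw : P.map β = gaussianReal 0 h.toNNReal) : ∫ ω, β ω ^ 2 ∂P = h := by
  have := variance_fun_id_gaussianReal (μ := 0) (v := h.toNNReal)
  rw [variance_eq_integral (by fun_prop), integral_id_gaussianReal, ← hlaw,
    integral_map hβ.aemeasurable (by fun_prop)] at this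
  simpa [hh] using this

lemma integral_abs_cube_of_map_eq_gaussianReal (hh : 0 ≤ h) (hβ : Measurable β)
    (hlaw : P.map β = gaussianReal 0 h.toNNReal) :
    ∫ ω, |β ω| ^ 3 ∂P = h * √h * ∫ x, |x| ^ 3 ∂gaussianReal 0 1 := by
  have hmap : gaussianReal 0 h.toNNReal = (gaussianReal 0 1).map (√h * ·) := by
    rw [gaussianReal_map_const_mul]
    congr 1
    · simp
    · ext
      simp [hh]
  have e : ∫ ω, |β ω| ^ 3 ∂P = ∫ x, |x| ^ 3 ∂(P.map β) :=
    (integral_map (f := fun x : ℝ => |x| ^ 3) hβ.aemeasurable (by fun_prop)).symm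
  rw [e, hlaw, hmap, integral_map (by fun_prop) (by fun_prop), ← integral_const_mul]
  refine integral_congr_ae (Filter.Eventually.of_forall fun x => ?_)
  simp only [abs_mul, abs_of_nonneg (Real.sqrt_nonneg h), mul_pow]
  rw [pow_succ √h 2, Real.sq_sqrt hh]

end Moments

/-- A variable known at the start of a step is uncorrelated with functions of the increment over
that step. -/
lemma integral_mul_of_indep {Ω : Type*} {ms m : MeasurableSpace Ω} {P : Measure Ω}
    (hms : ms ≤ m) {Y β : Ω → ℝ} (hY : Measurable[ms] Y) (hβ : Measurable β)
    (hind : Indep (MeasurableSpace.comap β inferInstance) ms P) {φ : ℝ → ℝ} (hφ : Measurable φ) :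
    ∫ ω, Y ω * φ (β ω) ∂P = (∫ ω, Y ω ∂P) * ∫ ω, φ (β ω) ∂P := by
  have h1 : IndepFun Y β P :=
    (IndepFun_iff_Indep _ _ _).2 (indep_of_indep_of_le_right hind hY.comap_le).symm
  have h2 : IndepFun Y (φ ∘ β) P := h1.comp measurable_id hφ
  exact h2.integral_mul_eq_mul_integral (hY.mono hms le_rfl).aestronglyMeasurable
    (hφ.comp hβ).aestronglyMeasurable

lemma integral_step_le {Ω : Type*} {ms m : MeasurableSpace Ω} {P : Measure Ω}
    [IsProbabilityMeasure P] (hms : ms ≤ m) {w x y β : Ω → ℝ}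
    {h L M : ℝ} {b G G₁ G₂ : ℝ → ℝ} (hG : IsTestFunction b G G₁ G₂ L M) (hh : 0 ≤ h)
    (hw : Measurable[ms] w) (hw0 : ∀ ω, 0 ≤ w ω) (hw1 : ∀ ω, w ω ≤ 1) (hx : Measurable[ms] x)
    (hy : Measurable y) (hβ : Measurable β)
    (hind : Indep (MeasurableSpace.comap β inferInstance) ms P)
    (hlaw : P.map β = gaussianReal 0 h.toNNReal) :
    Integrable (fun ω => w ω * stepDefect G G₁ G₂ L h (x ω) (y ω) (β ω)) P ∧
    Integrable (fun ω => w ω * (G (y ω) - G (x ω))) P ∧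
    ∫ ω, w ω * (G (y ω) - G (x ω)) ∂P ≤
      ∫ ω, w ω * stepDefect G G₁ G₂ L h (x ω) (y ω) (β ω) ∂P +
        L * (h * √h * ∫ x, |x| ^ 3 ∂gaussianReal 0 1) := by
  have hL := hG.const_nonneg
  have hGm := hG.continuous.measurable
  have hG₁m := hG.continuous_deriv.measurable
  have hG₂m := hG.continuous_deriv_deriv.measurable
  have hwm : Measurable w := hw.mono hms le_rfl
  have hxm : Measurable x := hx.mono hms le_rfl
  have hwb : ∀ ω, |w ω| ≤ 1 := fun ω => by rw [abs_of_nonneg (hw0 ω)]; exact hw1 ω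
  have iβ : Integrable β P := memLp_one_iff_integrable.1
    (by simpa using memLp_of_map_eq_gaussianReal hβ hlaw 1)
  have iβ2 : Integrable (fun ω => β ω ^ 2) P := by
    simpa using integrable_abs_pow_of_map_eq_gaussianReal hβ hlaw two_ne_zero
  have iβ3 := integrable_abs_pow_of_map_eq_gaussianReal hβ hlaw three_ne_zero
  have hA : Measurable[ms] fun ω => w ω * G₁ (x ω) := hw.mul (hG₁m.comp hx)
  have hC : Measurable[ms] fun ω => w ω * (G₂ (x ω) / 2) := hw.mul ((hG₂m.comp hx).div_const 2)
  have i1 : Integrable (fun ω => w ω * (G (y ω) - G (x ω))) P := by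
    refine Integrable.of_bound (C := M) (by fun_prop) (Filter.Eventually.of_forall fun ω => ?_)
    rw [norm_mul, ← one_mul M]
    refine mul_le_mul (hwb ω) ?_ (norm_nonneg _) zero_le_one
    rw [Real.norm_eq_abs, abs_le]
    constructor <;> linarith [hG.nonneg (x ω), hG.nonneg (y ω), hG.le (x ω), hG.le (y ω)]
  have i2 : Integrable (fun ω => w ω * G₁ (x ω) * β ω) P := by
    refine iβ.bdd_mul (c := L) (by fun_prop) (Filter.Eventually.of_forall fun ω => ?_)
    rw [norm_mul, ← one_mul L]
    exact mul_le_mul (hwb ω) (hG.abs_deriv_le _) (norm_nonneg _) zero_le_one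
  have i3 : Integrable (fun ω => w ω * (G₂ (x ω) / 2) * (β ω ^ 2 - h)) P := by
    refine (iβ2.sub (integrable_const h)).bdd_mul (c := L) (by fun_prop)
      (Filter.Eventually.of_forall fun ω => ?_)
    rw [norm_mul, ← one_mul L]
    refine mul_le_mul (hwb ω) ?_ (norm_nonneg _) zero_le_one
    have := hG.abs_deriv_deriv_le (x ω)
    rw [norm_div, Real.norm_eq_abs, Real.norm_two]
    linarith
  have i4 : Integrable (fun ω => w ω * (L * |β ω| ^ 3)) P :=
    (iβ3.const_mul L).bdd_mul (c := 1) (by fun_prop) (Filter.Eventually.of_forall hwb)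
  have z2 : ∫ ω, w ω * G₁ (x ω) * β ω ∂P = 0 := by
    rw [integral_mul_of_indep hms hA hβ hind (φ := fun u => u) measurable_id']
    simp [integral_eq_zero_of_map_eq_gaussianReal hβ hlaw]
  have z3 : ∫ ω, w ω * (G₂ (x ω) / 2) * (β ω ^ 2 - h) ∂P = 0 := by
    rw [integral_mul_of_indep hms hC hβ hind (φ := fun u => u ^ 2 - h) (by fun_prop),
      integral_sub iβ2 (integrable_const h), integral_sq_of_map_eq_gaussianReal hh hβ hlaw]
    simp
  have z4 : ∫ ω, w ω * (L * |β ω| ^ 3) ∂P ≤ L * (h * √h * ∫ x, |x| ^ 3 ∂gaussianReal 0 1) := by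
    rw [← integral_abs_cube_of_map_eq_gaussianReal hh hβ hlaw, ← integral_const_mul]
    exact integral_mono i4 (iβ3.const_mul L) fun ω =>
      mul_le_of_le_one_left (by positivity) (hw1 ω)
  have e : (fun ω => w ω * stepDefect G G₁ G₂ L h (x ω) (y ω) (β ω)) = fun ω =>
      w ω * (G (y ω) - G (x ω)) - w ω * G₁ (x ω) * β ω -
        w ω * (G₂ (x ω) / 2) * (β ω ^ 2 - h) - w ω * (L * |β ω| ^ 3) := by
    ext ω
    unfold stepDefect
    ring
  have i12 : Integrable (fun ω => w ω * (G (y ω) - G (x ω)) - w ω * G₁ (x ω) * β ω) P := i1.sub i2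
  have i123 : Integrable (fun ω => w ω * (G (y ω) - G (x ω)) - w ω * G₁ (x ω) * β ω -
      w ω * (G₂ (x ω) / 2) * (β ω ^ 2 - h)) P := i12.sub i3
  refine ⟨e ▸ i123.sub i4, i1, ?_⟩
  rw [e, integral_sub i123 i4, integral_sub i12 i3, integral_sub i1 i2, z2, z3]
  linarith

lemma mul_sub_le_sum_of_antitone {w g : ℕ → ℝ} (hw : Antitone w) (hg : ∀ i, 0 ≤ g i) (n : ℕ) :
    w n * g n - w 0 * g 0 ≤ ∑ i ∈ Finset.range n, w i * (g (i + 1) - g i) := by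
  induction n with
  | zero => simp
  | succ n ih =>
    rw [Finset.sum_range_succ]
    nlinarith [mul_le_mul_of_nonneg_right (hw (Nat.le_succ n)) (hg (n + 1))]

lemma measurable_lintegral_comp_path {Ω : Type*} {m : MeasurableSpace Ω} {X : ℝ → Ω → ℝ}
    {b : ℝ → ℝ} {t : ℝ} (ht : 0 ≤ t) (hb : Measurable b) (hc : ∀ ω, Continuous fun s => X s ω)
    (hX : ∀ s ∈ Icc 0 t, Measurable (X s)) :
    Measurable fun ω => ∫⁻ s in Icc 0 t, ‖b (X s ω)‖ₑ := by
  have h1 : Measurable (Function.uncurry fun (s : ℝ) ω => X (max 0 (min s t)) ω) :=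
    measurable_uncurry_of_continuous_of_measurable (fun ω => (hc ω).comp (by fun_prop))
      fun s => hX _ ⟨le_max_left _ _, max_le ht (min_le_right _ _)⟩
  have h2 : Measurable fun ω => ∫⁻ s in Icc 0 t, ‖b (X (max 0 (min s t)) ω)‖ₑ :=
    (hb.comp h1).enorm.lintegral_prod_left'
  convert h2 using 2 with ω
  refine setLIntegral_congr_fun measurableSet_Icc fun s hs => ?_
  simp [hs.1, hs.2]

lemma IsDrivenPath.driftVariation_le_iff {b x B : ℝ → ℝ} {T K t : ℝ} (h : IsDrivenPath b x B T)
    (hK : 0 ≤ K) (ht : t ∈ Icc 0 T) :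
    driftVariation b x t ≤ K ↔ ∫⁻ s in Icc 0 t, ‖b (x s)‖ₑ ≤ ENNReal.ofReal K := by
  have hi : IntegrableOn (fun s => b (x s)) (Icc 0 t) :=
    h.integrableOn.mono_set (Icc_subset_Icc le_rfl ht.2)
  rw [← ofReal_integral_norm_eq_lintegral_enorm hi, ENNReal.ofReal_le_ofReal_iff hK,
    integral_Icc_eq_integral_Ioc, ← intervalIntegral.integral_of_le ht.1]
  rfl

section WeakSolution

variable {Ω : Type*} {m : MeasurableSpace Ω} {P : Measure Ω} {F : ℝ → MeasurableSpace Ω}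
  {X B : ℝ → Ω → ℝ} {b : ℝ → ℝ} {S T K : ℝ}

lemma IsWeakSolutionOn.ae_isDrivenPath
    (h : IsWeakSolutionOn F P (fun _ x => b x) X B (fun _ => 0) S) (hT : 0 ≤ T) (hTS : T ≤ S) :
    ∀ᵐ ω ∂P, IsDrivenPath b (fun t => X t ω) (fun t => B t ω) T := by
  obtain ⟨-, -, hB, hXc, -, -, heq⟩ := h
  filter_upwards [heq] with ω hω
  refine ⟨hXc ω, hB.1 ω, (hω T ⟨hT, hTS⟩).1, fun t ht => ?_⟩
  simpa using (hω t ⟨ht.1, ht.2.trans hTS⟩).2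

/-- The weight which is `1` as long as the drift has accumulated total variation at most `K`. -/
def driftWeight (b : ℝ → ℝ) (X : ℝ → Ω → ℝ) (K t : ℝ) (ω : Ω) : ℝ :=
  if ∫⁻ s in Icc 0 t, ‖b (X s ω)‖ₑ ≤ ENNReal.ofReal K then 1 else 0

lemma driftWeight_nonneg (t : ℝ) (ω : Ω) : 0 ≤ driftWeight b X K t ω := by
  unfold driftWeight
  split_ifs <;> norm_num

lemma driftWeight_le_one (t : ℝ) (ω : Ω) : driftWeight b X K t ω ≤ 1 := by
  unfold driftWeight
  split_ifs <;> norm_num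

lemma antitone_driftWeight (ω : Ω) : Antitone fun t => driftWeight b X K t ω := by
  intro s t hst
  have : ∫⁻ u in Icc 0 s, ‖b (X u ω)‖ₑ ≤ ∫⁻ u in Icc 0 t, ‖b (X u ω)‖ₑ :=
    lintegral_mono_set (Icc_subset_Icc le_rfl hst)
  simp only [driftWeight]
  split_ifs with h1 h2 <;> norm_num
  exact h2 (this.trans h1)

lemma measurable_driftWeight (hb : Measurable b) (hc : ∀ ω, Continuous fun s => X s ω) {t : ℝ}
    (ht : 0 ≤ t) (hX : ∀ s ∈ Icc 0 t, Measurable (X s)) : Measurable (driftWeight b X K t) :=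
  Measurable.ite (measurableSet_le (measurable_lintegral_comp_path ht hb hc hX) measurable_const)
    measurable_const measurable_const

/-- Dynkin's inequality for a test function along a weak solution, restricted to the event that
the total variation of the drift is at most `K`. -/
lemma IsWeakSolutionOn.integral_driftWeight_mul_le [IsProbabilityMeasure P]
    (h : IsWeakSolutionOn F P (fun _ x => b x) X B (fun _ => 0) S) (hb : Measurable b)
    {G G₁ G₂ : ℝ → ℝ} {L M : ℝ} (hG : IsTestFunction b G G₁ G₂ L M) (hT : 0 ≤ T) (hTS : T ≤ S)
    (hK : 0 ≤ K) : ∫ ω, driftWeight b X K T ω * G (X T ω) ∂P ≤ T := by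
  have hpath := h.ae_isDrivenPath hT hTS
  obtain ⟨hFm, hFmono, ⟨-, -, hBm, hBind, hBlaw⟩, hXc, hXm, hX0, -⟩ := h
  have hXm' : ∀ t, 0 ≤ t → Measurable (X t) := fun t ht => (hXm t ht).mono (hFm t ht) le_rfl
  have hBm' : ∀ t, 0 ≤ t → Measurable (B t) := fun t ht => (hBm t ht).mono (hFm t ht) le_rfl
  have hwm : ∀ t, 0 ≤ t → Measurable[F t] (driftWeight b X K t) := fun t ht =>
    measurable_driftWeight hb hXc ht fun s hs => (hXm s hs.1).mono (hFmono s t hs.1 hs.2) le_rfl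
  have hGm := hG.continuous.measurable
  set c : ℝ := L * ∫ x, |x| ^ 3 ∂gaussianReal 0 1 with hc
  set D : ℕ → Ω → ℝ := fun n ω => ∑ i ∈ Finset.range n, driftWeight b X K (gridPoint T n i) ω *
    stepDefect G G₁ G₂ L (T / n) (X (gridPoint T n i) ω) (X (gridPoint T n (i + 1)) ω)
      (B (gridPoint T n (i + 1)) ω - B (gridPoint T n i) ω) with hD
  have hstep := fun n i => by
    have h0 := gridPoint_nonneg hT n i
    have h1 : gridPoint T n i ≤ gridPoint T n (i + 1) := monotone_gridPoint hT n (Nat.le_succ i)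
    have hlaw := hBlaw _ _ h0 h1
    rw [gridPoint_succ_sub] at hlaw
    exact integral_step_le (hFm _ h0) hG (h := T / n)
      (β := fun ω => B (gridPoint T n (i + 1)) ω - B (gridPoint T n i) ω) (by positivity) (hwm _ h0)
      (driftWeight_nonneg _) (driftWeight_le_one _) (hXm _ h0) (hXm' _ (h0.trans h1))
      ((hBm' _ (h0.trans h1)).sub (hBm' _ h0)) (hBind _ _ h0 h1) hlaw
  have hDi : ∀ n, Integrable (D n) P := fun n => integrable_finsetSum _ fun i _ => (hstep n i).1
  set Z : ℕ → Ω → ℝ := fun n ω => max (D n ω - T) 0 with hZ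
  have hZi : ∀ n, Integrable (Z n) P := fun n => ((hDi n).sub (integrable_const T)).pos_part
  have hZbound : ∀ n, ∀ᵐ ω ∂P, ‖Z n ω‖ ≤ L * K + M + L * T := by
    intro n
    filter_upwards [hpath] with ω hω
    have hs := hω.sum_stepDefect_le hG hT hK n
    have hDω : D n ω ≤ L * K + M + L * T := by
      refine le_of_eq_of_le (Finset.sum_congr rfl fun i hi => ?_) hs
      congr 1
      exact (if_congr (hω.driftVariation_le_iff hK
        (gridPoint_mem_Icc hT (Finset.mem_range.1 hi).le)) rfl rfl).symm
    have hL := hG.const_nonneg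
    have hM := hG.bound_nonneg
    rw [Real.norm_of_nonneg (le_max_right _ _)]
    exact max_le (by linarith) (by positivity)
  have hZlim : ∀ᵐ ω ∂P, Filter.Tendsto (fun n => Z n ω) Filter.atTop (nhds 0) := by
    filter_upwards [hpath] with ω hω
    rw [Metric.tendsto_nhds]
    intro ε hε
    filter_upwards [hω.eventually_sum_stepDefect_le hG hT
      (fun t => driftWeight_nonneg (b := b) (X := X) (K := K) t ω)
      (fun t => driftWeight_le_one t ω) (half_pos hε)] with n hn
    have hDn : D n ω ≤ T + ε / 2 := hn
    rw [Real.dist_eq, sub_zero, abs_of_nonneg (le_max_right _ _)]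
    exact max_lt (by linarith) hε
  have hZint : Filter.Tendsto (fun n => ∫ ω, Z n ω ∂P) Filter.atTop (nhds 0) := by
    have := tendsto_integral_of_dominated_convergence (fun _ => L * K + M + L * T)
      (fun n => (hZi n).aestronglyMeasurable) (integrable_const _) hZbound hZlim
    simpa using this
  have hbound : ∀ n : ℕ, n ≠ 0 → ∫ ω, driftWeight b X K T ω * G (X T ω) ∂P ≤
      T + ∫ ω, Z n ω ∂P + c * (T * √(T / n)) := by
    intro n hn
    have hsum : ∀ᵐ ω ∂P, driftWeight b X K T ω * G (X T ω) ≤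
        ∑ i ∈ Finset.range n, driftWeight b X K (gridPoint T n i) ω *
          (G (X (gridPoint T n (i + 1)) ω) - G (X (gridPoint T n i) ω)) := by
      filter_upwards [hX0] with ω hω
      have := mul_sub_le_sum_of_antitone
        (w := fun i => driftWeight b X K (gridPoint T n i) ω)
        (g := fun i => G (X (gridPoint T n i) ω))
        ((antitone_driftWeight ω).comp_monotone (monotone_gridPoint hT n))
        (fun i => hG.nonneg _) n
      simpa [gridPoint_self T hn, gridPoint_zero, hω, hG.zero] using this
    have hint : Integrable (fun ω => driftWeight b X K T ω * G (X T ω)) P := by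
      have hw := (hwm T hT).mono (hFm T hT) le_rfl
      have hx := hXm' T hT
      refine Integrable.of_bound (C := M) (by fun_prop) (Filter.Eventually.of_forall fun ω => ?_)
      rw [Real.norm_of_nonneg (mul_nonneg (driftWeight_nonneg _ _) (hG.nonneg _))]
      exact (mul_le_of_le_one_left (hG.nonneg _) (driftWeight_le_one _ _)).trans (hG.le _)
    calc _ ≤ ∫ ω, ∑ i ∈ Finset.range n, driftWeight b X K (gridPoint T n i) ω *
          (G (X (gridPoint T n (i + 1)) ω) - G (X (gridPoint T n i) ω)) ∂P :=
          integral_mono_ae hint (integrable_finsetSum _ fun i _ => (hstep n i).2.1) hsum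
      _ ≤ ∑ i ∈ Finset.range n, (∫ ω, driftWeight b X K (gridPoint T n i) ω *
            stepDefect G G₁ G₂ L (T / n) (X (gridPoint T n i) ω) (X (gridPoint T n (i + 1)) ω)
              (B (gridPoint T n (i + 1)) ω - B (gridPoint T n i) ω) ∂P +
            L * (T / n * √(T / n) * ∫ x, |x| ^ 3 ∂gaussianReal 0 1)) := by
          rw [integral_finsetSum _ fun i _ => (hstep n i).2.1]
          exact Finset.sum_le_sum fun i _ => (hstep n i).2.2
      _ = ∫ ω, D n ω ∂P + c * (T * √(T / n)) := by
          rw [Finset.sum_add_distrib, hD, integral_finsetSum _ fun i _ => (hstep n i).1]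
          congr 1
          rw [Finset.sum_const, Finset.card_range, nsmul_eq_mul, hc]
          field_simp
      _ ≤ _ := by
          have : ∫ ω, D n ω ∂P ≤ ∫ ω, (T + Z n ω) ∂P :=
            integral_mono (hDi n) ((integrable_const T).add (hZi n)) fun ω => by
              have := le_max_left (D n ω - T) 0
              simp only [hZ]
              linarith
          rw [integral_add (integrable_const T) (hZi n)] at this
          simp only [integral_const, probReal_univ, one_smul] at this
          linarith
  have hlim : Filter.Tendsto (fun n : ℕ => T + ∫ ω, Z n ω ∂P + c * (T * √(T / n)))
      Filter.atTop (nhds T) := by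
    have h1 : Filter.Tendsto (fun n : ℕ => √(T / n)) Filter.atTop (nhds 0) := by
      simpa using (tendsto_const_div_atTop_nhds_zero_nat T).sqrt
    simpa using (hZint.const_add T).add ((h1.const_mul T).const_mul c)
  exact ge_of_tendsto hlim ((Filter.eventually_ne_atTop 0).mono hbound)

end WeakSolution

lemma measurable_bSing {f : ℝ → ℝ} (hf : Measurable f) : Measurable (bSing f) :=
  Measurable.ite (((measurableSet_singleton 0).compl).inter
      (measurableSet_le measurable_id.abs measurable_const)) (by fun_prop)
    (Measurable.ite (measurableSet_lt measurable_const measurable_id.abs) hf measurable_const)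

lemma IsWeakSolutionOn.ae_eq_zero {Ω : Type*} {m : MeasurableSpace Ω} {P : Measure Ω}
    [IsProbabilityMeasure P] {F : ℝ → MeasurableSpace Ω} {X B : ℝ → Ω → ℝ} {f : ℝ → ℝ} {S T : ℝ}
    (h : IsWeakSolutionOn F P (fun _ x => bSing f x) X B (fun _ => 0) S) (hf : Measurable f)
    (hT : 0 ≤ T) (hTS : T ≤ S) : ∀ᵐ ω ∂P, X T ω = 0 := by
  have hb := measurable_bSing hf
  have hXm : ∀ t, 0 ≤ t → Measurable (X t) := fun t ht => (h.2.2.2.2.1 t ht).mono (h.1 t ht) le_rfl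
  have key : ∀ K : ℕ, ∀ k : ℕ, ∀ᵐ ω ∂P, ¬ (driftWeight (bSing f) X K T ω = 1 ∧
      1 / ((k : ℝ) + 2) ≤ |X T ω|) := by
    intro K k
    have hwm : Measurable (driftWeight (bSing f) X K T) :=
      measurable_driftWeight hb h.2.2.2.1 hT fun s hs => hXm s hs.1
    set E : Set Ω := {ω | driftWeight (bSing f) X K T ω = 1 ∧ 1 / ((k : ℝ) + 2) ≤ |X T ω|} with hE
    have hEm : MeasurableSet E := (hwm (measurableSet_singleton 1)).inter
      (measurableSet_le measurable_const (hXm T hT).abs)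
    have hmul : ∀ C : ℝ, C * P.real E ≤ T := by
      intro C
      obtain ⟨G, G₁, G₂, L, M, hG, hGC⟩ := exists_isTestFunction_ge f
        (r := 1 / ((k : ℝ) + 2)) (by positivity)
        (by rw [div_lt_one (by positivity)]; linarith [k.cast_nonneg (α := ℝ)]) C
      refine le_trans ?_ (h.integral_driftWeight_mul_le hb hG hT hTS K.cast_nonneg)
      have hGm := hG.continuous.measurable
      have hx := hXm T hT
      have e : C * P.real E = ∫ ω, E.indicator (fun _ => C) ω ∂P := by
        rw [integral_indicator_const _ hEm, smul_eq_mul, mul_comm]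
      rw [e]
      refine integral_mono ((integrable_const C).indicator hEm) ?_ fun ω => ?_
      · refine Integrable.of_bound (C := M) (by fun_prop) (Filter.Eventually.of_forall fun ω => ?_)
        rw [Real.norm_of_nonneg (mul_nonneg (driftWeight_nonneg _ _) (hG.nonneg _))]
        exact (mul_le_of_le_one_left (hG.nonneg _) (driftWeight_le_one _ _)).trans (hG.le _)
      · by_cases hω : ω ∈ E
        · simp only [indicator_of_mem hω, hω.1, one_mul]
          exact hGC _ hω.2
        · simp only [indicator_of_notMem hω]
          exact mul_nonneg (driftWeight_nonneg _ _) (hG.nonneg _)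
    have hzero : P.real E = 0 := by
      by_contra hne
      have := hmul ((T + 1) / P.real E)
      rw [div_mul_cancel₀ _ hne] at this
      linarith
    rw [ae_iff]
    simpa [hE] using (measureReal_eq_zero_iff).1 hzero
  filter_upwards [h.ae_isDrivenPath hT hTS, ae_all_iff.2 fun K => ae_all_iff.2 (key K)]
    with ω hω hkey
  by_contra hne
  obtain ⟨K, hK⟩ := exists_nat_ge (driftVariation (bSing f) (fun t => X t ω) T)
  obtain ⟨k, hk⟩ := exists_nat_one_div_lt (abs_pos.2 hne)
  refine hkey K k ⟨if_pos ((hω.driftVariation_le_iff K.cast_nonneg ⟨hT, le_rfl⟩).1 hK), ?_⟩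
  refine le_trans ?_ hk.le
  gcongr
  norm_num

/-- There is no weak solution on `[0, 1/2]` with initial condition `0` to
`dX = bSing f (X) dt + dB`, for any measurable `f`. -/
theorem stmt8 (f : ℝ → ℝ) (hf : Measurable f) :
    ∀ (Ω : Type) (m : MeasurableSpace Ω) (P : Measure Ω), IsProbabilityMeasure P →
    ∀ (F : ℝ → MeasurableSpace Ω) (X B : ℝ → Ω → ℝ),
      ¬ IsWeakSolutionOn F P (fun _ x => bSing f x) X B (fun _ => 0) (1/2) := by
  intro Ω _ P hP F X B h
  have hX : ∀ᵐ ω ∂P, ∀ q : ℚ, X (max 0 (min (q : ℝ) (1 / 2))) ω = 0 :=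
    ae_all_iff.2 fun q => h.ae_eq_zero hf (le_max_left _ _)
      (max_le (by norm_num) (min_le_right _ _))
  have hB : ∀ᵐ ω ∂P, B (1 / 2) ω = 0 := by
    filter_upwards [hX, h.ae_isDrivenPath (T := 1 / 2) (by norm_num) le_rfl] with ω hω hpath
    have hcont : Continuous fun t : ℝ => X (max 0 (min t (1 / 2))) ω :=
      hpath.continuous.comp (by fun_prop)
    have hzero : (fun t : ℝ => X (max 0 (min t (1 / 2))) ω) = fun _ => 0 :=
      Continuous.ext_on Rat.denseRange_cast hcont continuous_const
        (by rintro _ ⟨q, rfl⟩; exact hω q)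
    have hX0 : ∀ t ∈ Icc (0 : ℝ) (1 / 2), X t ω = 0 := fun t ht => by
      have := congrFun hzero t
      rwa [min_eq_left ht.2, max_eq_right ht.1] at this
    have heq := hpath.eq (1 / 2) (by norm_num)
    have hint : ∫ s in (0:ℝ)..(1 / 2), bSing f (X s ω) = ∫ s in (0:ℝ)..(1 / 2), (0 : ℝ) := by
      refine intervalIntegral.integral_congr fun s hs => ?_
      rw [uIcc_of_le (by norm_num)] at hs
      simp [hX0 s hs, bSing]
    rw [hint, hX0 _ (by norm_num)] at heq
    simpa using heq.symm
  obtain ⟨hFm, -, ⟨-, hB0, hBm, -, hBlaw⟩, -⟩ := h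
  have hmeas : ∀ t, 0 ≤ t → Measurable (B t) := fun t ht => (hBm t ht).mono (hFm t ht) le_rfl
  have hsq := integral_sq_of_map_eq_gaussianReal (by norm_num)
    ((hmeas (1 / 2) (by norm_num)).sub (hmeas 0 le_rfl))
    (hBlaw 0 (1 / 2) le_rfl (by norm_num))
  have hz : ∫ ω, (B (1 / 2) ω - B 0 ω) ^ 2 ∂P = 0 :=
    integral_eq_zero_of_ae (by filter_upwards [hB, hB0] with ω h1 h2; rw [h1, h2]; simp)
  have := hsq.symm.trans hz
  norm_num at this
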